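/- Mass and energy of the modified profiles Q_b: there exist C > 0 and b₀ > 0 such that for all b ∈ ℝ with 0 < |b| < b₀: |∫ Q_b² − ∫ Q² − 2b ∫ PQ| ≤ C |b|^{5/4} and |E(Q_b) + b ∫ PQ| ≤ C b². -/

import Mathlib

open MeasureTheory Filter Set Topology

noncomputable section

/-- The ground state `Q(x) = (3 / cosh(2x)^2)^(1/4)`. -/
def Q : ℝ → ℝ := fun x => (3 / Real.cosh (2 * x) ^ 2) ^ ((1 : ℝ) / 4)

/-- `u` is a solution of the mass-critical gKdV equation on the time set `I`:
smooth on `I × ℝ`, satisfies `∂ₜ u + ∂ₓ(∂ₓ² u + u⁵) = 0` pointwise, and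
`u(t,·)`, `∂ₓ u(t,·)` are square integrable for each `t ∈ I`. -/
def SolvesGKdV (I : Set ℝ) (u : ℝ → ℝ → ℝ) : Prop :=
  ContDiffOn ℝ (⊤ : ℕ∞) (fun p : ℝ × ℝ => u p.1 p.2) (I ×ˢ (univ : Set ℝ)) ∧
  (∀ t ∈ I, ∀ x : ℝ,
    deriv (fun s => u s x) t
      + deriv (fun y => deriv (fun z => deriv (u t) z) y + (u t y) ^ 5) x = 0) ∧
  (∀ t ∈ I, Integrable (fun x => (u t x) ^ 2)) ∧
  (∀ t ∈ I, Integrable (fun x => (deriv (u t) x) ^ 2))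

/-- `L²` norm. -/
def L2norm (v : ℝ → ℝ) : ℝ := Real.sqrt (∫ x : ℝ, (v x) ^ 2)

/-- `H¹` norm. -/
def H1norm (v : ℝ → ℝ) : ℝ := Real.sqrt (∫ x : ℝ, ((v x) ^ 2 + (deriv v x) ^ 2))

/-- Energy `E(v) = (1/2)∫ (v')² − (1/6)∫ v⁶`. -/
def Energy (v : ℝ → ℝ) : ℝ :=
  (1 / 2) * (∫ x : ℝ, (deriv v x) ^ 2) - (1 / 6) * ∫ x : ℝ, (v x) ^ 6

/-- `v` belongs to the soliton tube `𝒯_α`. -/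
def InTube (α : ℝ) (v : ℝ → ℝ) : Prop :=
  ∃ lam₀ : ℝ, 0 < lam₀ ∧ ∃ x₀ : ℝ,
    L2norm (fun x => v x - (1 / Real.sqrt lam₀) * Q ((x - x₀) / lam₀)) < α

/-- `u₀` belongs to the set `𝒜(α₀)` of initial data. -/
def InA (α₀ : ℝ) (u₀ : ℝ → ℝ) : Prop :=
  H1norm (fun x => u₀ x - Q x) < α₀ ∧
  (∫ y in Ioi (0 : ℝ), y ^ 10 * (u₀ y - Q y) ^ 2) < 1

/-- Generator of the `L²` scaling applied to `Q`: `ΛQ = Q/2 + y Q'`. -/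
def LambdaQ : ℝ → ℝ := fun y => Q y / 2 + y * deriv Q y

/-- The properties characterizing the profile `P`. -/
def IsProfileP (P : ℝ → ℝ) : Prop :=
  ContDiff ℝ (⊤ : ℕ∞) P ∧
  (∀ k : ℕ, 1 ≤ k → ∃ C r : ℝ, 0 < C ∧ 0 < r ∧
    ∀ y : ℝ, |iteratedDeriv k P y| ≤ C * (1 + |y|) ^ r * Real.exp (-|y|)) ∧
  (∀ y : ℝ,
    deriv (fun z => -(deriv (deriv P) z) + P z - 5 * (Q z) ^ 4 * P z) y = LambdaQ y) ∧
  Tendsto P atBot (nhds ((1 / 2) * ∫ y : ℝ, Q y)) ∧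
  Tendsto P atTop (nhds 0)

/-- The properties of the fixed cutoff `χ`. -/
def IsCutoff (χ : ℝ → ℝ) : Prop :=
  ContDiff ℝ (⊤ : ℕ∞) χ ∧ (∀ y, 0 ≤ χ y ∧ χ y ≤ 1) ∧ (∀ y, 0 ≤ deriv χ y) ∧
  (∀ y : ℝ, -1 ≤ y → χ y = 1) ∧ (∀ y : ℝ, y ≤ -2 → χ y = 0)

/-- Modified profile `Q_b = Q + b χ_b P` with `χ_b(y) = χ(|b|^{3/4} y)`. -/
def Qb (P χ : ℝ → ℝ) (b : ℝ) : ℝ → ℝ :=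
  fun y => Q y + b * χ (|b| ^ ((3 : ℝ) / 4) * y) * P y

/-- Geometric decomposition of a solution `u` on `I`, with orthogonality conditions. -/
def GeomDecomp (I : Set ℝ) (u : ℝ → ℝ → ℝ) (P χ : ℝ → ℝ)
    (lam x b : ℝ → ℝ) (eps : ℝ → ℝ → ℝ) : Prop :=
  (∀ t ∈ I, 0 < lam t) ∧
  (∀ t ∈ I, ∀ y : ℝ,
    Real.sqrt (lam t) * u t (lam t * y + x t) = Qb P χ (b t) y + eps t y) ∧
  (∀ t ∈ I, (∫ y : ℝ, eps t y * (y * LambdaQ y)) = 0) ∧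
  (∀ t ∈ I, (∫ y : ℝ, eps t y * LambdaQ y) = 0) ∧
  (∀ t ∈ I, (∫ y : ℝ, eps t y * Q y) = 0)

/-- Minimal-mass blow-up solution on `(T, t₀]`. -/
def MinimalMassBlowup (T t₀ : ℝ) (u : ℝ → ℝ → ℝ) : Prop :=
  SolvesGKdV (Ioc T t₀) u ∧
  (∀ t ∈ Ioc T t₀, (∫ x : ℝ, (u t x) ^ 2) = ∫ x : ℝ, (Q x) ^ 2) ∧
  Tendsto (fun t => L2norm (deriv (u t))) (nhdsWithin T (Ioi T)) atTop

/-- Minimal-mass blow-up solution on `(0,∞)` blowing up backward at `0`. -/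
def MinimalBlowupAtZero (S : ℝ → ℝ → ℝ) : Prop :=
  SolvesGKdV (Ioi 0) S ∧
  (∀ t : ℝ, 0 < t → (∫ x : ℝ, (S t x) ^ 2) = ∫ x : ℝ, (Q x) ^ 2) ∧
  Tendsto (fun t => L2norm (deriv (S t))) (nhdsWithin 0 (Ioi 0)) atTop

/-- Smooth solution of the Airy equation `∂ₜ w + ∂ₓ³ w = 0`. -/
def SolvesAiry (w : ℝ → ℝ → ℝ) : Prop :=
  ContDiff ℝ (⊤ : ℕ∞) (fun p : ℝ × ℝ => w p.1 p.2) ∧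
  ∀ t x : ℝ,
    deriv (fun s => w s x) t + deriv (fun y => deriv (fun z => deriv (w t) z) y) x = 0

/-- `u` scatters at `+∞` in `L²`. -/
def ScattersAtTop (u : ℝ → ℝ → ℝ) : Prop :=
  ∃ w : ℝ → ℝ → ℝ, SolvesAiry w ∧
    Tendsto (fun t => L2norm (fun x => u t x - w t x)) atTop (nhds 0)

/-- Continuous functions on the line bounded by a multiple of `exp (-|y| / 2)`. -/
def HasExpDecay (f : ℝ → ℝ) : Prop :=
  Continuous f ∧ ∃ C : ℝ, 0 ≤ C ∧ ∀ y, |f y| ≤ C * Real.exp (-|y| / 2)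

lemma integrable_exp_neg_abs_half : Integrable fun y : ℝ => Real.exp (-|y| / 2) := by
  rw [← integrableOn_univ, ← Iic_union_Ioi (a := (0 : ℝ))]
  refine IntegrableOn.union ?_ ?_
  · refine (integrableOn_exp_mul_Iic (a := 1 / 2) (by norm_num) 0).congr_fun (fun y hy => ?_)
      measurableSet_Iic
    simp only [abs_of_nonpos (mem_Iic.1 hy)]
    ring_nf
  · refine (integrableOn_exp_mul_Ioi (a := -(1 / 2)) (by norm_num) 0).congr_fun (fun y hy => ?_)
      measurableSet_Ioi
    simp only [abs_of_pos (mem_Ioi.1 hy)]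
    ring_nf

lemma exp_neg_abs_half_le_one (y : ℝ) : Real.exp (-|y| / 2) ≤ 1 :=
  Real.exp_le_one_iff.2 (by have := abs_nonneg y; linarith)

namespace HasExpDecay

variable {f g : ℝ → ℝ}

lemma integrable (hf : HasExpDecay f) : Integrable f := by
  obtain ⟨hc, C, -, hC⟩ := hf
  exact (integrable_exp_neg_abs_half.const_mul C).mono' hc.aestronglyMeasurable
    (Eventually.of_forall hC)

lemma add (hf : HasExpDecay f) (hg : HasExpDecay g) : HasExpDecay fun y => f y + g y := by
  obtain ⟨hf, C, hC0, hC⟩ := hf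
  obtain ⟨hg, D, hD0, hD⟩ := hg
  refine ⟨hf.add hg, C + D, by positivity, fun y => (abs_add_le _ _).trans ?_⟩
  rw [add_mul]
  exact add_le_add (hC y) (hD y)

lemma bounded_mul (hg : HasExpDecay g) (hf : Continuous f) {M : ℝ} (hM : ∀ y, |f y| ≤ M) :
    HasExpDecay fun y => f y * g y := by
  obtain ⟨hg, D, hD0, hD⟩ := hg
  have hM0 : 0 ≤ M := (abs_nonneg _).trans (hM 0)
  refine ⟨hf.mul hg, M * D, by positivity, fun y => ?_⟩
  rw [abs_mul, mul_assoc]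
  exact mul_le_mul (hM y) (hD y) (abs_nonneg _) hM0

lemma const_mul (hg : HasExpDecay g) (c : ℝ) : HasExpDecay fun y => c * g y :=
  hg.bounded_mul continuous_const fun _ => le_rfl

lemma mul (hf : HasExpDecay f) (hg : HasExpDecay g) : HasExpDecay fun y => f y * g y := by
  obtain ⟨hf, C, hC0, hC⟩ := hf
  refine hg.bounded_mul hf (M := C) fun y => (hC y).trans ?_
  exact mul_le_of_le_one_right hC0 (exp_neg_abs_half_le_one y)

lemma pow (hf : HasExpDecay f) (n : ℕ) : HasExpDecay fun y => f y ^ (n + 1) := by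
  induction n with
  | zero => simpa using hf
  | succ n ih => simpa only [pow_succ _ (n + 1)] using ih.mul hf

end HasExpDecay

lemma hasDerivAt_tanh_two_mul (y : ℝ) :
    HasDerivAt (fun z => Real.tanh (2 * z)) (2 * (1 - Real.tanh (2 * y) ^ 2)) y := by
  have hc : Real.cosh (2 * y) ≠ 0 := (Real.cosh_pos _).ne'
  have h2 : HasDerivAt (fun z : ℝ => 2 * z) 2 y := by simpa using (hasDerivAt_id y).const_mul 2
  have h := (h2.sinh).div h2.cosh hc
  simp only [Real.tanh_eq_sinh_div_cosh]
  refine h.congr_deriv ?_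
  field_simp

lemma Q_pos (y : ℝ) : 0 < Q y :=
  Real.rpow_pos_of_pos (div_pos three_pos (pow_pos (Real.cosh_pos _) 2)) _

lemma Q_pow_four (y : ℝ) : Q y ^ 4 = 3 / Real.cosh (2 * y) ^ 2 := by
  have h : 0 ≤ 3 / Real.cosh (2 * y) ^ 2 := by positivity
  rw [Q, ← Real.rpow_natCast, ← Real.rpow_mul h]
  norm_num

lemma Q_pow_four_eq_tanh (y : ℝ) : Q y ^ 4 = 3 * (1 - Real.tanh (2 * y) ^ 2) := by
  have hc : Real.cosh (2 * y) ≠ 0 := (Real.cosh_pos _).ne'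
  have h := Real.cosh_sq_sub_sinh_sq (2 * y)
  rw [Q_pow_four, Real.tanh_eq_sinh_div_cosh]
  field_simp
  linarith

lemma hasDerivAt_Q (y : ℝ) : HasDerivAt Q (-(Real.tanh (2 * y) * Q y)) y := by
  have hc : Real.cosh (2 * y) ≠ 0 := (Real.cosh_pos _).ne'
  have h2 : HasDerivAt (fun z : ℝ => 2 * z) 2 y := by simpa using (hasDerivAt_id y).const_mul 2
  have hg0 : 0 < 3 / Real.cosh (2 * y) ^ 2 := by positivity
  have hg := ((hasDerivAt_const y (3 : ℝ)).div (h2.cosh.pow 2) (pow_ne_zero 2 hc))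
  have h := hg.rpow_const (p := 1 / 4) (Or.inl hg0.ne')
  refine h.congr_deriv ?_
  simp only [Pi.div_apply, Pi.pow_apply]
  rw [Real.rpow_sub_one hg0.ne', Real.tanh_eq_sinh_div_cosh, Q]
  field_simp
  ring

lemma deriv_Q (y : ℝ) : deriv Q y = -(Real.tanh (2 * y) * Q y) := (hasDerivAt_Q y).deriv

lemma hasDerivAt_deriv_Q (y : ℝ) : HasDerivAt (deriv Q) (Q y - Q y ^ 5) y := by
  have h := ((hasDerivAt_tanh_two_mul y).mul (hasDerivAt_Q y)).neg
  rw [funext deriv_Q]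
  refine h.congr_deriv ?_
  rw [pow_succ (Q y) 4, Q_pow_four_eq_tanh]
  ring

lemma Q_le (y : ℝ) : Q y ≤ 2 * Real.exp (-|y|) := by
  have hc : Real.exp (2 * |y|) / 2 ≤ Real.cosh (2 * y) := by
    rw [← Real.cosh_abs, abs_mul, abs_two, Real.cosh_eq]
    have := Real.exp_pos (-(2 * |y|))
    linarith
  have he := Real.exp_pos (2 * |y|)
  refine le_of_pow_le_pow_left₀ (n := 4) (by norm_num) (by positivity) ?_
  rw [Q_pow_four, mul_pow, ← Real.exp_nat_mul, div_le_iff₀ (by positivity)]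
  have h1 : (Real.exp (2 * |y|) / 2) ^ 2 ≤ Real.cosh (2 * y) ^ 2 := by gcongr
  have h2 : Real.exp ((4 : ℕ) * -|y|) * Real.exp (2 * |y|) ^ 2 = 1 := by
    rw [← Real.exp_nat_mul, ← Real.exp_add, Real.exp_eq_one_iff]
    push_cast
    ring
  have h3 := mul_le_mul_of_nonneg_left h1 (Real.exp_pos ((4 : ℕ) * -|y|)).le
  rw [div_pow, ← mul_div_assoc, h2] at h3
  nlinarith

lemma Q_le_exp_half (y : ℝ) : Q y ≤ 2 * Real.exp (-|y| / 2) :=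
  (Q_le y).trans <| by
    have := abs_nonneg y
    gcongr
    linarith

lemma Q_le_two (y : ℝ) : Q y ≤ 2 :=
  (Q_le_exp_half y).trans (by linarith [exp_neg_abs_half_le_one y])

lemma sq_mul_Q_le (y : ℝ) : y ^ 2 * Q y ≤ 16 * Real.exp (-|y| / 2) := by
  have h1 := Real.quadratic_le_exp_of_nonneg (x := |y| / 2) (by positivity)
  have h2 : y ^ 2 ≤ 8 * Real.exp (|y| / 2) := by
    have := abs_nonneg y
    rw [← sq_abs]
    nlinarith
  calc y ^ 2 * Q y ≤ 8 * Real.exp (|y| / 2) * (2 * Real.exp (-|y|)) :=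
        mul_le_mul h2 (Q_le y) (Q_pos y).le (by positivity)
    _ = 16 * (Real.exp (|y| / 2) * Real.exp (-|y|)) := by ring
    _ = 16 * Real.exp (-|y| / 2) := by rw [← Real.exp_add]; ring_nf

lemma continuous_Q : Continuous Q :=
  continuous_iff_continuousAt.2 fun y => (hasDerivAt_Q y).continuousAt

lemma hasExpDecay_Q : HasExpDecay Q :=
  ⟨continuous_Q, 2, two_pos.le, fun y => by
    rw [abs_of_pos (Q_pos y)]; exact Q_le_exp_half y⟩

lemma hasExpDecay_deriv_Q : HasExpDecay (deriv Q) := by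
  refine ⟨continuous_iff_continuousAt.2 fun y => (hasDerivAt_deriv_Q y).continuousAt,
    2, two_pos.le, fun y => ?_⟩
  have h : |Real.tanh (2 * y)| ≤ 1 := (Real.abs_tanh_lt_one _).le
  rw [deriv_Q, abs_neg, abs_mul, abs_of_pos (Q_pos y)]
  calc |Real.tanh (2 * y)| * Q y ≤ 1 * Q y := by gcongr; exact (Q_pos y).le
    _ ≤ _ := by rw [one_mul]; exact Q_le_exp_half y

lemma deriv_Q_sq (y : ℝ) : deriv Q y ^ 2 = Q y ^ 2 - Q y ^ 6 / 3 := by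
  have h : Q y ^ 6 = Q y ^ 4 * Q y ^ 2 := by ring
  rw [deriv_Q, h, Q_pow_four_eq_tanh]
  ring

lemma one_add_rpow_mul_exp_neg_le {t r : ℝ} (ht : 0 ≤ t) :
    (1 + t) ^ r * Real.exp (-t) ≤
      2 ^ ⌈r⌉₊ * (⌈r⌉₊.factorial : ℝ) * Real.exp (1 / 2) * Real.exp (-t / 2) := by
  have h1 : (1 + t) ^ r ≤ (1 + t) ^ ⌈r⌉₊ := by
    rw [← Real.rpow_natCast]
    exact Real.rpow_le_rpow_of_exponent_le (by linarith) (Nat.le_ceil r)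
  have h2 := Real.pow_div_factorial_le_exp ((1 + t) / 2) (by positivity) ⌈r⌉₊
  rw [div_le_iff₀ (by positivity), div_pow, div_le_iff₀ (by positivity)] at h2
  calc (1 + t) ^ r * Real.exp (-t)
      ≤ Real.exp ((1 + t) / 2) * (⌈r⌉₊.factorial : ℝ) * 2 ^ ⌈r⌉₊ * Real.exp (-t) := by
        gcongr; exact h1.trans h2
    _ = 2 ^ ⌈r⌉₊ * (⌈r⌉₊.factorial : ℝ) * (Real.exp ((1 + t) / 2) * Real.exp (-t)) := by ring
    _ = 2 ^ ⌈r⌉₊ * (⌈r⌉₊.factorial : ℝ) * (Real.exp (1 / 2) * Real.exp (-t / 2)) := by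
        rw [← Real.exp_add, ← Real.exp_add]; ring_nf
    _ = _ := by ring

lemma hasDerivAt_exp_mul (c y : ℝ) :
    HasDerivAt (fun z => Real.exp (c * z)) (c * Real.exp (c * y)) y := by
  have h : HasDerivAt (fun z => c * z) c y := by simpa using (hasDerivAt_id y).const_mul c
  simpa [mul_comm] using h.exp

/-- A function with exponentially decaying derivative which vanishes at `+∞` is bounded, and
decays exponentially on the right half-line. -/
lemma abs_le_of_deriv_le_exp {f f' : ℝ → ℝ} {C : ℝ} (hf : ∀ y, HasDerivAt f (f' y) y)
    (hC : ∀ y, |f' y| ≤ C * Real.exp (-|y| / 2)) (hlim : Tendsto f atTop (𝓝 0)) :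
    (∀ y, 0 ≤ y → |f y| ≤ 2 * C * Real.exp (-|y| / 2)) ∧ ∀ y, |f y| ≤ |f 0| + 2 * C := by
  have hC0 : 0 ≤ C := by simpa using (abs_nonneg _).trans (hC 0)
  have hcont : Continuous f := continuous_iff_continuousAt.2 fun y => (hf y).continuousAt
  have hcexp : ∀ c : ℝ, Continuous fun y : ℝ => Real.exp (c * y) := fun c => by fun_prop
  have hd (A c y : ℝ) : HasDerivAt (fun z => f z + A * Real.exp (c * z))
      (f' y + A * (c * Real.exp (c * y))) y := (hf y).add ((hasDerivAt_exp_mul c y).const_mul A)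
  have hright : ∀ y, 0 ≤ y → |f y| ≤ 2 * C * Real.exp (-|y| / 2) := by
    have hexp : Tendsto (fun y : ℝ => Real.exp (-(1 / 2) * y)) atTop (𝓝 0) :=
      Real.tendsto_exp_atBot.comp
        ((tendsto_const_mul_atBot_of_neg (by norm_num)).2 tendsto_id)
    have hl (A : ℝ) : Tendsto (fun z => f z + A * Real.exp (-(1 / 2) * z)) atTop (𝓝 0) := by
      simpa using hlim.add (hexp.const_mul A)
    have hanti : AntitoneOn (fun z => f z + 2 * C * Real.exp (-(1 / 2) * z)) (Ici 0) := by
      refine antitoneOn_of_hasDerivWithinAt_nonpos (convex_Ici 0)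
        (by have := hcexp (-(1 / 2)); fun_prop) (fun x _ => (hd _ _ x).hasDerivWithinAt)
        fun x hx => ?_
      rw [interior_Ici, mem_Ioi] at hx
      have h := (abs_le.1 (hC x)).2
      rw [abs_of_pos hx, show -x / 2 = -(1 / 2) * x by ring] at h
      linarith
    have hmono : MonotoneOn (fun z => f z + -(2 * C) * Real.exp (-(1 / 2) * z)) (Ici 0) := by
      refine monotoneOn_of_hasDerivWithinAt_nonneg (convex_Ici 0)
        (by have := hcexp (-(1 / 2)); fun_prop) (fun x _ => (hd _ _ x).hasDerivWithinAt)
        fun x hx => ?_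
      rw [interior_Ici, mem_Ioi] at hx
      have h := (abs_le.1 (hC x)).1
      rw [abs_of_pos hx, show -x / 2 = -(1 / 2) * x by ring] at h
      linarith
    intro y hy
    have h1 := le_of_tendsto (hl (2 * C))
      ((eventually_ge_atTop y).mono fun z hz => hanti hy (hy.trans hz) hz)
    have h2 := ge_of_tendsto (hl (-(2 * C)))
      ((eventually_ge_atTop y).mono fun z hz => hmono hy (hy.trans hz) hz)
    rw [abs_of_nonneg hy, show -y / 2 = -(1 / 2) * y by ring, abs_le]
    constructor <;> linarith
  refine ⟨hright, fun y => ?_⟩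
  rcases le_total 0 y with hy | hy
  · have h1 := hright y hy
    have h2 := exp_neg_abs_half_le_one y
    have h3 := abs_nonneg (f 0)
    nlinarith
  · have hanti : AntitoneOn (fun z => f z + -(2 * C) * Real.exp (1 / 2 * z)) (Iic 0) := by
      refine antitoneOn_of_hasDerivWithinAt_nonpos (convex_Iic 0)
        (by have := hcexp (1 / 2); fun_prop) (fun x _ => (hd _ _ x).hasDerivWithinAt)
        fun x hx => ?_
      rw [interior_Iic, mem_Iio] at hx
      have h := (abs_le.1 (hC x)).2
      rw [abs_of_neg hx, show - -x / 2 = 1 / 2 * x by ring] at h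
      linarith
    have hmono : MonotoneOn (fun z => f z + 2 * C * Real.exp (1 / 2 * z)) (Iic 0) := by
      refine monotoneOn_of_hasDerivWithinAt_nonneg (convex_Iic 0)
        (by have := hcexp (1 / 2); fun_prop) (fun x _ => (hd _ _ x).hasDerivWithinAt)
        fun x hx => ?_
      rw [interior_Iic, mem_Iio] at hx
      have h := (abs_le.1 (hC x)).1
      rw [abs_of_neg hx, show - -x / 2 = 1 / 2 * x by ring] at h
      linarith
    have h1 := hanti hy (self_mem_Iic (a := (0 : ℝ))) hy
    have h2 := hmono hy (self_mem_Iic (a := (0 : ℝ))) hy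
    simp only [mul_zero, Real.exp_zero, mul_one] at h1 h2
    have h3 : 0 ≤ 2 * C * Real.exp (1 / 2 * y) := by positivity
    have h4 := abs_le.1 (le_refl |f 0|)
    rw [abs_le]
    constructor <;> linarith

/-- The profile `P` is bounded and decays exponentially on the right half-line, and its derivative
decays exponentially. -/
lemma IsProfileP.exists_bound {P : ℝ → ℝ} (hP : IsProfileP P) :
    ∃ M : ℝ, 1 ≤ M ∧ (∀ y, |P y| ≤ M) ∧ (∀ y, 0 ≤ y → |P y| ≤ M * Real.exp (-|y| / 2)) ∧
      ∀ y, |deriv P y| ≤ M * Real.exp (-|y| / 2) := by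
  obtain ⟨hsmooth, hdec, -, -, hlim⟩ := hP
  obtain ⟨C, r, hC, -, hb⟩ := hdec 1 le_rfl
  simp only [iteratedDeriv_one] at hb
  set D := C * (2 ^ ⌈r⌉₊ * (⌈r⌉₊.factorial : ℝ) * Real.exp (1 / 2)) with hD
  have hD0 : 0 ≤ D := by positivity
  have hPD : ∀ y, |deriv P y| ≤ D * Real.exp (-|y| / 2) := fun y => by
    refine (hb y).trans ?_
    rw [hD, mul_assoc, mul_assoc C]
    exact mul_le_mul_of_nonneg_left (one_add_rpow_mul_exp_neg_le (abs_nonneg y)) hC.le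
  have hdiff : Differentiable ℝ P := hsmooth.differentiable (by simp)
  obtain ⟨h1, h2⟩ := abs_le_of_deriv_le_exp (fun y => (hdiff y).hasDerivAt) hPD hlim
  have h0 := abs_nonneg (P 0)
  refine ⟨|P 0| + 2 * D + 1, by linarith, fun y => (h2 y).trans (by linarith),
    fun y hy => (h1 y hy).trans ?_, fun y => (hPD y).trans ?_⟩ <;>
  · gcongr
    linarith

lemma IsCutoff.exists_deriv_bound {χ : ℝ → ℝ} (hχ : IsCutoff χ) :
    ∃ K : ℝ, 0 ≤ K ∧ (∀ y, |deriv χ y| ≤ K) ∧ ∀ y, y ∉ Icc (-2 : ℝ) 0 → deriv χ y = 0 := by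
  obtain ⟨hsmooth, -, -, h1, h0⟩ := hχ
  have hcont : Continuous (deriv χ) := hsmooth.continuous_deriv (by simp)
  have hz : ∀ y, y ∉ Icc (-2 : ℝ) 0 → deriv χ y = 0 := fun y hy => by
    rw [mem_Icc, not_and_or, not_le, not_le] at hy
    rcases hy with hy | hy
    · have : χ =ᶠ[𝓝 y] fun _ => 0 := (eventually_lt_nhds hy).mono fun z hz => h0 z hz.le
      rw [this.deriv_eq, deriv_const]
    · have : χ =ᶠ[𝓝 y] fun _ => 1 :=
        (eventually_gt_nhds hy).mono fun z hz => h1 z (by linarith)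
      rw [this.deriv_eq, deriv_const]
  obtain ⟨K, hK⟩ := (isCompact_Icc (a := (-2 : ℝ)) (b := 0)).exists_bound_of_continuousOn
    hcont.continuousOn
  have hK0 : 0 ≤ K := (norm_nonneg _).trans (hK 0 (by simp))
  refine ⟨K, hK0, fun y => ?_, hz⟩
  by_cases hy : y ∈ Icc (-2 : ℝ) 0
  · exact hK y hy
  · rw [hz y hy, abs_zero]; exact hK0

lemma integral_indicator_Icc {a : ℝ} (ha : 0 < a) :
    ∫ y : ℝ, (Icc (-(2 / a)) 0).indicator (fun _ => (1 : ℝ)) y = 2 / a := by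
  have h : 0 ≤ 2 / a := by positivity
  rw [integral_indicator_const _ measurableSet_Icc, Real.volume_real_Icc_of_le (by linarith)]
  simp

lemma abs_integral_le_of_abs_le {f : ℝ → ℝ} {a A B : ℝ} (ha : 0 < a)
    (h : ∀ y, |f y| ≤ A * Real.exp (-|y| / 2) +
      B * (Icc (-(2 / a)) 0).indicator (fun _ => (1 : ℝ)) y) :
    |∫ y, f y| ≤ A * (∫ y : ℝ, Real.exp (-|y| / 2)) + B * (2 / a) := by
  have hE := integrable_exp_neg_abs_half.const_mul A
  have hI : Integrable fun y => B * (Icc (-(2 / a)) 0).indicator (fun _ => (1 : ℝ)) y :=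
    Integrable.const_mul
      ((integrable_indicator_iff measurableSet_Icc).2 (integrableOn_const (by simp))) B
  have hEI : Integrable fun y => A * Real.exp (-|y| / 2) +
      B * (Icc (-(2 / a)) 0).indicator (fun _ => (1 : ℝ)) y := hE.add hI
  calc |∫ y, f y| ≤ ∫ y, (A * Real.exp (-|y| / 2) +
        B * (Icc (-(2 / a)) 0).indicator (fun _ => (1 : ℝ)) y) :=
        norm_integral_le_of_norm_le (f := f) hEI (Eventually.of_forall h)
    _ = _ := by
      rw [integral_add hE hI, integral_const_mul, integral_const_mul, integral_indicator_Icc ha]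

lemma indicator_Icc_le_exp {a : ℝ} (y : ℝ) :
    (Icc (-(2 / a)) 0).indicator (fun _ => (1 : ℝ)) y ≤
      Real.exp (1 / a) * Real.exp (-|y| / 2) := by
  refine indicator_le' (f := fun _ : ℝ => (1 : ℝ))
    (g := fun y => Real.exp (1 / a) * Real.exp (-|y| / 2))
    (fun y hy => ?_) (fun y _ => by positivity) y
  rw [← Real.exp_add, Real.one_le_exp_iff, abs_of_nonpos hy.2]
  have := hy.1
  have h : 2 / a = 2 * (1 / a) := by ring
  linarith

lemma IsCutoff.abs_sub_one_le {χ : ℝ → ℝ} (hχ : IsCutoff χ) (y : ℝ) : |χ y - 1| ≤ y ^ 2 := by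
  obtain ⟨-, h01, -, h1, -⟩ := hχ
  rcases le_total (-1) y with hy | hy
  · rw [h1 y hy]; simpa using sq_nonneg y
  · have := h01 y
    rw [abs_le]
    constructor <;> nlinarith

lemma hasDerivAt_cutoff_mul {P χ : ℝ → ℝ} (hP : Differentiable ℝ P) (hχ : Differentiable ℝ χ)
    (a y : ℝ) : HasDerivAt (fun z => χ (a * z) * P z)
      (a * deriv χ (a * y) * P y + χ (a * y) * deriv P y) y := by
  have h : HasDerivAt (fun z => a * z) a y := by simpa using (hasDerivAt_id y).const_mul a
  have h2 : HasDerivAt (fun z => χ (a * z)) (deriv χ (a * y) * a) y :=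
    (hχ (a * y)).hasDerivAt.comp y h
  refine (h2.mul (hP y).hasDerivAt).congr_deriv ?_
  ring

lemma abs_cutoff_mul_le {P χ : ℝ → ℝ} (hχ : IsCutoff χ) {M a : ℝ} (ha : 0 < a) (hM0 : 0 ≤ M)
    (hM : ∀ y, |P y| ≤ M) (hdec : ∀ y, 0 ≤ y → |P y| ≤ M * Real.exp (-|y| / 2)) (y : ℝ) :
    |χ (a * y) * P y| ≤ M * (Real.exp (-|y| / 2) +
      (Icc (-(2 / a)) 0).indicator (fun _ => (1 : ℝ)) y) := by
  obtain ⟨-, h01, -, -, h0⟩ := hχ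
  have hE := Real.exp_pos (-|y| / 2)
  have hI : 0 ≤ (Icc (-(2 / a)) 0).indicator (fun _ => (1 : ℝ)) y :=
    indicator_nonneg (fun _ _ => zero_le_one) y
  have hle : |χ (a * y) * P y| ≤ |P y| := by
    rw [abs_mul, abs_of_nonneg (h01 _).1]
    exact mul_le_of_le_one_left (abs_nonneg _) (h01 _).2
  rcases le_total 0 y with hy | hy
  · refine (hle.trans (hdec y hy)).trans (mul_le_mul_of_nonneg_left ?_ hM0)
    linarith
  · by_cases hy2 : -(2 / a) ≤ y
    · rw [indicator_of_mem (show y ∈ Icc (-(2 / a)) 0 from ⟨hy2, hy⟩)]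
      refine (hle.trans (hM y)).trans (le_mul_of_one_le_right hM0 ?_)
      linarith
    · have : a * y ≤ -2 := by
        have h := mul_le_mul_of_nonneg_left (not_le.1 hy2).le ha.le
        rwa [mul_neg, mul_div_cancel₀ _ ha.ne'] at h
      rw [h0 _ this, zero_mul, abs_zero]
      positivity

lemma abs_deriv_cutoff_mul_le {P χ : ℝ → ℝ} (hχ : IsCutoff χ) {K M a : ℝ} (ha : 0 < a)
    (hK : ∀ y, |deriv χ y| ≤ K) (hχz : ∀ y, y ∉ Icc (-2 : ℝ) 0 → deriv χ y = 0)
    (hM : ∀ y, |P y| ≤ M) (hP' : ∀ y, |deriv P y| ≤ M * Real.exp (-|y| / 2)) (y : ℝ) :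
    |a * deriv χ (a * y) * P y + χ (a * y) * deriv P y| ≤ M * Real.exp (-|y| / 2) +
      a * K * M * (Icc (-(2 / a)) 0).indicator (fun _ => (1 : ℝ)) y := by
  obtain ⟨-, h01, -, -, -⟩ := hχ
  have h1 : |χ (a * y) * deriv P y| ≤ M * Real.exp (-|y| / 2) := by
    rw [abs_mul, abs_of_nonneg (h01 _).1]
    exact (mul_le_of_le_one_left (abs_nonneg _) (h01 _).2).trans (hP' y)
  have h2 : |a * deriv χ (a * y) * P y| ≤
      a * K * M * (Icc (-(2 / a)) 0).indicator (fun _ => (1 : ℝ)) y := by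
    by_cases hy : y ∈ Icc (-(2 / a)) 0
    · rw [indicator_of_mem hy, abs_mul, abs_mul, abs_of_pos ha, mul_one]
      have hK0 : 0 ≤ K := (abs_nonneg _).trans (hK 0)
      gcongr
      exacts [hK _, hM _]
    · have : a * y ∉ Icc (-2 : ℝ) 0 := fun h => hy
        ⟨by rw [← neg_div, div_le_iff₀' ha]; exact h.1,
          nonpos_of_mul_nonpos_right h.2 ha⟩
      rw [hχz _ this, indicator_of_notMem hy]
      simp
  linarith [abs_add_le (a * deriv χ (a * y) * P y) (χ (a * y) * deriv P y)]

lemma sq_le_of_abs_le_add_indicator {x A B E I : ℝ} (hE : 0 ≤ E) (hE1 : E ≤ 1)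
    (hI : I = 0 ∨ I = 1) (h : |x| ≤ A * E + B * I) :
    x ^ 2 ≤ 2 * A ^ 2 * E + 2 * B ^ 2 * I := by
  have h2 : x ^ 2 ≤ (A * E + B * I) ^ 2 := by
    rw [← sq_abs]; gcongr
  have h3 : E ^ 2 ≤ E := by nlinarith
  have h4 : I ^ 2 = I := by rcases hI with rfl | rfl <;> norm_num
  calc x ^ 2 ≤ (A * E + B * I) ^ 2 := h2
    _ ≤ 2 * A ^ 2 * E ^ 2 + 2 * B ^ 2 * I ^ 2 := by nlinarith [sq_nonneg (A * E - B * I)]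
    _ ≤ _ := by rw [h4]; gcongr

/-- The part of order at least two in the expansion of `(q + b w) ^ 6`, divided by `b ^ 2`, without
its last term. -/
lemma abs_sextic_remainder_le {q b w M : ℝ} (hq : 0 ≤ q) (hq2 : q ≤ 2) (hb : |b| ≤ 1)
    (hw : |w| ≤ M) :
    |15 * q ^ 4 * w ^ 2 + 20 * b * q ^ 3 * w ^ 3 + 15 * b ^ 2 * q ^ 2 * w ^ 4
        + 6 * b ^ 3 * q * w ^ 5| ≤
      (120 * M ^ 2 + 80 * M ^ 3 + 30 * M ^ 4 + 6 * M ^ 5) * q := by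
  have hM : 0 ≤ M := (abs_nonneg _).trans hw
  have key (i j k : ℕ) : |b ^ i * q ^ (j + 1) * w ^ k| ≤ 2 ^ j * M ^ k * q := by
    rw [abs_mul, abs_mul, abs_pow, abs_pow, abs_pow, abs_of_nonneg hq]
    calc |b| ^ i * q ^ (j + 1) * |w| ^ k ≤ 1 * (2 ^ j * q) * M ^ k := by
          rw [pow_succ]
          gcongr
          exact pow_le_one₀ (abs_nonneg _) hb
      _ = _ := by ring
  have h1 := abs_le.1 (key 0 3 2)
  have h2 := abs_le.1 (key 1 2 3)
  have h3 := abs_le.1 (key 2 1 4)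
  have h4 := abs_le.1 (key 3 0 5)
  norm_num at h1 h2 h3 h4
  rw [abs_le]
  constructor <;> nlinarith

/-- The truncated profile `χ (a ·) P` and its derivative: exponential decay, and quadratic bounds
which are uniform in the truncation scale. -/
lemma exists_truncated_profile_bounds {P χ : ℝ → ℝ} (hP : IsProfileP P) (hχ : IsCutoff χ) :
    ∃ M K : ℝ, 1 ≤ M ∧ (∀ y, |P y| ≤ M) ∧ ∀ a : ℝ, 0 < a →
      HasExpDecay (fun y => χ (a * y) * P y) ∧
      HasExpDecay (fun y => a * deriv χ (a * y) * P y + χ (a * y) * deriv P y) ∧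
      (∀ y, |χ (a * y) * P y| ≤ M) ∧
      (∀ y, (χ (a * y) * P y) ^ 2 ≤ 2 * M ^ 2 * Real.exp (-|y| / 2) +
        2 * M ^ 2 * (Icc (-(2 / a)) 0).indicator (fun _ => (1 : ℝ)) y) ∧
      ∀ y, (a * deriv χ (a * y) * P y + χ (a * y) * deriv P y) ^ 2 ≤
        2 * M ^ 2 * Real.exp (-|y| / 2) +
        2 * (a * K * M) ^ 2 * (Icc (-(2 / a)) 0).indicator (fun _ => (1 : ℝ)) y := by
  obtain ⟨M, hM1, hM, hdec, hdec'⟩ := hP.exists_bound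
  obtain ⟨K, hK0, hK, hχz⟩ := hχ.exists_deriv_bound
  refine ⟨M, K, hM1, hM, fun a ha => ?_⟩
  have hM0 : 0 ≤ M := by linarith
  have hPc : Continuous P := hP.1.continuous
  have hχc : Continuous χ := hχ.1.continuous
  have hP'c : Continuous (deriv P) := hP.1.continuous_deriv (by simp)
  have hχ'c : Continuous (deriv χ) := hχ.1.continuous_deriv (by simp)
  have h1 := abs_cutoff_mul_le hχ ha hM0 hM hdec
  have h2 := abs_deriv_cutoff_mul_le hχ ha hK hχz hM hdec'
  have hE (y : ℝ) : 0 ≤ Real.exp (-|y| / 2) := (Real.exp_pos _).le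
  have hI (y : ℝ) : (Icc (-(2 / a)) 0).indicator (fun _ => (1 : ℝ)) y = 0 ∨
      (Icc (-(2 / a)) 0).indicator (fun _ => (1 : ℝ)) y = 1 := indicator_eq_zero_or_self _ _ _
  refine ⟨⟨by fun_prop, M * (1 + Real.exp (1 / a)), by positivity, fun y => ?_⟩,
    ⟨by fun_prop, M + a * K * M * Real.exp (1 / a), by positivity, fun y => ?_⟩,
    fun y => ?_, fun y => ?_, fun y => ?_⟩
  · refine (h1 y).trans ?_
    rw [mul_assoc, add_mul, one_mul]
    gcongr
    exact indicator_Icc_le_exp y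
  · refine (h2 y).trans ?_
    rw [add_mul, mul_assoc (a * K * M)]
    gcongr
    exact indicator_Icc_le_exp y
  · rw [abs_mul, abs_of_nonneg (hχ.2.1 _).1]
    exact (mul_le_of_le_one_left (abs_nonneg _) (hχ.2.1 _).2).trans (hM y)
  · refine sq_le_of_abs_le_add_indicator (hE y) (exp_neg_abs_half_le_one y) (hI y) ?_
    rw [← mul_add]
    exact h1 y
  · exact sq_le_of_abs_le_add_indicator (hE y) (exp_neg_abs_half_le_one y) (hI y) (h2 y)

lemma abs_cutoff_error_le {P χ : ℝ → ℝ} (hχ : IsCutoff χ) {M : ℝ} (hM : ∀ y, |P y| ≤ M)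
    (a y : ℝ) :
    |(χ (a * y) - 1) * P y * Q y| ≤ 16 * M * a ^ 2 * Real.exp (-|y| / 2) := by
  have hM0 : 0 ≤ M := (abs_nonneg _).trans (hM 0)
  rw [abs_mul, abs_mul, abs_of_pos (Q_pos y)]
  calc |χ (a * y) - 1| * |P y| * Q y ≤ (a * y) ^ 2 * M * Q y := by
        have := hχ.abs_sub_one_le (a * y)
        have := hM y
        have := (Q_pos y).le
        gcongr
    _ = M * a ^ 2 * (y ^ 2 * Q y) := by ring
    _ ≤ M * a ^ 2 * (16 * Real.exp (-|y| / 2)) :=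
        mul_le_mul_of_nonneg_left (sq_mul_Q_le y) (by positivity)
    _ = _ := by ring

/-- Expansion of the mass density of `Q + b w` around `Q`. -/
lemma mass_expansion {P χ : ℝ → ℝ} (hP : IsProfileP P) (hχ : IsCutoff χ) :
    ∃ C : ℝ, 0 ≤ C ∧ ∀ a b : ℝ, 0 < a → a ≤ 1 → a ^ 2 ≤ |b| →
      |(∫ y, (Q y + b * χ (a * y) * P y) ^ 2) - (∫ y, Q y ^ 2) - 2 * b * ∫ y, P y * Q y| ≤
        C * (b ^ 2 / a) := by
  obtain ⟨M, K, hM1, hM, hw⟩ := exists_truncated_profile_bounds hP hχ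
  have hJ : 0 ≤ ∫ y : ℝ, Real.exp (-|y| / 2) := integral_nonneg fun y => (Real.exp_pos _).le
  refine ⟨(32 * M + 2 * M ^ 2) * (∫ y : ℝ, Real.exp (-|y| / 2)) + 4 * M ^ 2,
    by positivity, fun a b ha ha1 hab => ?_⟩
  obtain ⟨hwd, -, -, hw2, -⟩ := hw a ha
  have hQP : HasExpDecay fun y => P y * Q y := hasExpDecay_Q.bounded_mul hP.1.continuous hM
  have hQb : HasExpDecay fun y => Q y + b * χ (a * y) * P y := by
    simpa only [mul_assoc] using hasExpDecay_Q.add (hwd.const_mul b)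
  have i1 := (hQb.pow 1).integrable
  have i2 := (hasExpDecay_Q.pow 1).integrable
  have i3 := (hQP.const_mul (2 * b)).integrable
  have i12 : Integrable fun y => (Q y + b * χ (a * y) * P y) ^ 2 - Q y ^ 2 := i1.sub i2
  rw [← integral_const_mul, ← integral_sub i1 i2, ← integral_sub i12 i3]
  refine (abs_integral_le_of_abs_le (A := b ^ 2 * (32 * M + 2 * M ^ 2)) (B := b ^ 2 * (2 * M ^ 2))
    ha fun y => ?_).trans ?_
  · have h1 := abs_cutoff_error_le hχ hM a y
    have h2 := hw2 y
    set E := Real.exp (-|y| / 2)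
    set I := (Icc (-(2 / a)) 0).indicator (fun _ => (1 : ℝ)) y
    have hE : 0 ≤ E := (Real.exp_pos _).le
    have e : (Q y + b * χ (a * y) * P y) ^ 2 - Q y ^ 2 - 2 * b * (P y * Q y) =
        2 * b * ((χ (a * y) - 1) * P y * Q y) + b ^ 2 * (χ (a * y) * P y) ^ 2 := by ring
    rw [e]
    refine (abs_add_le _ _).trans ?_
    rw [abs_mul (2 * b), abs_mul 2 b, abs_two, abs_of_nonneg (by positivity : 0 ≤ b ^ 2 * _)]
    calc 2 * |b| * |(χ (a * y) - 1) * P y * Q y| + b ^ 2 * (χ (a * y) * P y) ^ 2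
        ≤ 2 * |b| * (16 * M * |b| * E) + b ^ 2 * (2 * M ^ 2 * E + 2 * M ^ 2 * I) := by
          gcongr
          refine h1.trans ?_
          gcongr
      _ = b ^ 2 * (32 * M + 2 * M ^ 2) * E + b ^ 2 * (2 * M ^ 2) * I := by
          rw [← sq_abs b]; ring
  · have h : b ^ 2 ≤ b ^ 2 / a := le_div_self (sq_nonneg b) ha ha1
    have h3 := mul_le_mul_of_nonneg_right h
      (by positivity : 0 ≤ (32 * M + 2 * M ^ 2) * ∫ y : ℝ, Real.exp (-|y| / 2))
    have h4 : b ^ 2 * (2 * M ^ 2) * (2 / a) = 4 * M ^ 2 * (b ^ 2 / a) := by ring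
    rw [h4]
    linarith

/-- Expansion of the energy of `Q + b w` around `Q`. -/
lemma energy_expansion {P χ : ℝ → ℝ} (hP : IsProfileP P) (hχ : IsCutoff χ) :
    ∃ C : ℝ, 0 ≤ C ∧ ∀ a b : ℝ, 0 < a → a ≤ 1 → |b| ≤ 1 → a ^ 2 ≤ |b| → b ^ 2 ≤ a →
      |Energy (fun y => Q y + b * χ (a * y) * P y) + b * ∫ y, P y * Q y| ≤ C * b ^ 2 := by
  obtain ⟨M, K, hM1, hM, hw⟩ := exists_truncated_profile_bounds hP hχ
  have hJ : 0 ≤ ∫ y : ℝ, Real.exp (-|y| / 2) := integral_nonneg fun y => (Real.exp_pos _).le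
  set N := 120 * M ^ 2 + 80 * M ^ 3 + 30 * M ^ 4 + 6 * M ^ 5 with hN
  have hN0 : 0 ≤ N := by positivity
  refine ⟨(16 * M + M ^ 2 + N / 3 + M ^ 6) * (∫ y : ℝ, Real.exp (-|y| / 2)) +
    2 * ((K * M) ^ 2 + M ^ 6), by positivity, fun a b ha ha1 hb1 hab hba => ?_⟩
  obtain ⟨hwd, hwd', hwM, hw2, hw2'⟩ := hw a ha
  have hderiv := hasDerivAt_cutoff_mul (hP.1.differentiable (by simp))
    (hχ.1.differentiable (by simp)) a
  set w : ℝ → ℝ := fun y => χ (a * y) * P y with hwdef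
  set w' : ℝ → ℝ := fun y => a * deriv χ (a * y) * P y + χ (a * y) * deriv P y
  have hQP : HasExpDecay fun y => P y * Q y := hasExpDecay_Q.bounded_mul hP.1.continuous hM
  have hQb_eq : (fun y => Q y + b * χ (a * y) * P y) = fun y => Q y + b * w y := by
    ext y
    rw [hwdef, mul_assoc]
  have hQb : HasExpDecay fun y => Q y + b * w y := hasExpDecay_Q.add (hwd.const_mul b)
  have hQb' : HasExpDecay fun y => deriv Q y + b * w' y :=
    hasExpDecay_deriv_Q.add (hwd'.const_mul b)
  have hdQb : deriv (fun y => Q y + b * w y) = fun y => deriv Q y + b * w' y := by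
    ext y
    exact ((hasDerivAt_Q y).differentiableAt.hasDerivAt.add ((hderiv y).const_mul b)).deriv
  have hQ5 : HasExpDecay fun y => Q y - Q y ^ 5 := by
    simpa only [neg_one_mul, ← sub_eq_add_neg] using
      hasExpDecay_Q.add ((hasExpDecay_Q.pow 4).const_mul (-1))
  -- the total derivative in the energy density
  set g : ℝ → ℝ := fun y => 1 / 4 * (deriv Q y * Q y) + b * (deriv Q y * w y)
  set g' : ℝ → ℝ := fun y => 1 / 4 * ((Q y - Q y ^ 5) * Q y + deriv Q y * deriv Q y) +
    b * ((Q y - Q y ^ 5) * w y + deriv Q y * w' y)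
  have hg' : HasExpDecay g' :=
    (((hQ5.mul hasExpDecay_Q).add (hasExpDecay_deriv_Q.mul hasExpDecay_deriv_Q)).const_mul _).add
      (((hQ5.mul hwd).add (hasExpDecay_deriv_Q.mul hwd')).const_mul b)
  have hg0 : ∫ y, g' y = 0 := by
    refine integral_eq_zero_of_hasDerivAt_of_integrable (f := g) (fun y => ?_) hg'.integrable
      (((hasExpDecay_deriv_Q.mul hasExpDecay_Q).const_mul _).add
        ((hasExpDecay_deriv_Q.mul hwd).const_mul b)).integrable
    have hQ := (hasDerivAt_Q y).differentiableAt.hasDerivAt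
    exact (((hasDerivAt_deriv_Q y).mul hQ).const_mul (1 / 4)).add
      (((hasDerivAt_deriv_Q y).mul (hderiv y)).const_mul b)
  have i1 := ((hQb'.pow 1).const_mul (1 / 2)).integrable
  have i2 := ((hQb.pow 5).const_mul (1 / 6)).integrable
  have i3 := (hQP.const_mul b).integrable
  have i12 : Integrable fun y =>
      1 / 2 * (deriv Q y + b * w' y) ^ 2 - 1 / 6 * (Q y + b * w y) ^ 6 := i1.sub i2
  have i123 : Integrable fun y => 1 / 2 * (deriv Q y + b * w' y) ^ 2
      - 1 / 6 * (Q y + b * w y) ^ 6 + b * (P y * Q y) := i12.add i3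
  have key : Energy (fun y => Q y + b * w y) + b * ∫ y, P y * Q y =
      ∫ y, (1 / 2 * (deriv Q y + b * w' y) ^ 2 - 1 / 6 * (Q y + b * w y) ^ 6
        + b * (P y * Q y) - g' y) := by
    rw [integral_sub i123 hg'.integrable, hg0, sub_zero,
      integral_add i12 i3, integral_sub i1 i2, integral_const_mul, integral_const_mul,
      integral_const_mul, Energy, hdQb]
  rw [hQb_eq, key]
  have hb4 : b ^ 4 ≤ a := by
    have h0 := sq_nonneg b
    nlinarith
  refine (abs_integral_le_of_abs_le (A := b ^ 2 * (16 * M + M ^ 2 + N / 3 + M ^ 6))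
    (B := b ^ 2 * (a * ((K * M) ^ 2 + M ^ 6))) ha fun y => ?_).trans ?_
  · have h1 := abs_cutoff_error_le hχ hM a y
    have h2 := hw2 y
    have h3 := hw2' y
    have h4 := abs_sextic_remainder_le (Q_pos y).le (Q_le_two y) hb1 (hwM y)
    have hQE := Q_le_exp_half y
    have hdQ := deriv_Q_sq y
    have hwM4 : w y ^ 4 ≤ M ^ 4 := by
      have h := pow_le_pow_left₀ (abs_nonneg _) (hwM y) 4
      rwa [Even.pow_abs (by decide)] at h
    have hI : 0 ≤ (Icc (-(2 / a)) 0).indicator (fun _ => (1 : ℝ)) y :=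
      indicator_nonneg (fun _ _ => zero_le_one) y
    have hE : 0 ≤ Real.exp (-|y| / 2) := (Real.exp_pos _).le
    generalize Real.exp (-|y| / 2) = E at *
    generalize (Icc (-(2 / a)) 0).indicator (fun _ => (1 : ℝ)) y = I at *
    set T := 15 * Q y ^ 4 * w y ^ 2 + 20 * b * Q y ^ 3 * w y ^ 3 + 15 * b ^ 2 * Q y ^ 2 * w y ^ 4
        + 6 * b ^ 3 * Q y * w y ^ 5 with hT
    have e : 1 / 2 * (deriv Q y + b * w' y) ^ 2 - 1 / 6 * (Q y + b * w y) ^ 6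
        + b * (P y * Q y) - g' y =
        -(b * ((χ (a * y) - 1) * P y * Q y)) + b ^ 2 / 2 * w' y ^ 2 - b ^ 2 / 6 * T
          - b ^ 6 / 6 * (w y ^ 2 * w y ^ 4) := by
      have hw0 : (χ (a * y) - 1) * P y * Q y = w y * Q y - P y * Q y := by
        rw [hwdef]; ring
      rw [hw0, hT]
      simp only [g']
      linear_combination 1 / 4 * hdQ
    have t1 : |b * ((χ (a * y) - 1) * P y * Q y)| ≤ b ^ 2 * (16 * M) * E := by
      rw [abs_mul]
      calc |b| * |(χ (a * y) - 1) * P y * Q y| ≤ |b| * (16 * M * |b| * E) := by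
            gcongr
            refine h1.trans ?_
            gcongr
        _ = b ^ 2 * (16 * M) * E := by rw [← sq_abs b]; ring
    have t2 : b ^ 2 / 2 * w' y ^ 2 ≤ b ^ 2 * M ^ 2 * E + b ^ 2 * (a * (K * M) ^ 2) * I := by
      calc b ^ 2 / 2 * w' y ^ 2
          ≤ b ^ 2 / 2 * (2 * M ^ 2 * E + 2 * (a * K * M) ^ 2 * I) := by gcongr
        _ = b ^ 2 * M ^ 2 * E + b ^ 2 * (a * a * (K * M) ^ 2) * I := by ring
        _ ≤ b ^ 2 * M ^ 2 * E + b ^ 2 * (a * (K * M) ^ 2) * I := by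
          gcongr
          exact mul_le_of_le_one_left ha.le ha1
    have t3 : |b ^ 2 / 6 * T| ≤ b ^ 2 * (N / 3) * E := by
      rw [abs_mul, abs_of_nonneg (by positivity : 0 ≤ b ^ 2 / 6)]
      calc b ^ 2 / 6 * |T| ≤ b ^ 2 / 6 * (N * (2 * E)) := by
            gcongr
            refine h4.trans ?_
            gcongr
        _ = _ := by ring
    have t4 : b ^ 6 / 6 * (w y ^ 2 * w y ^ 4) ≤ b ^ 2 * M ^ 6 * E + b ^ 2 * (a * M ^ 6) * I := by
      calc b ^ 6 / 6 * (w y ^ 2 * w y ^ 4)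
          ≤ b ^ 6 / 6 * ((2 * M ^ 2 * E + 2 * M ^ 2 * I) * M ^ 4) := by gcongr
        _ = 1 / 3 * (b ^ 2 * (b ^ 4 * M ^ 6) * E + b ^ 2 * (b ^ 4 * M ^ 6) * I) := by ring
        _ ≤ 1 * (b ^ 2 * (1 * M ^ 6) * E + b ^ 2 * (a * M ^ 6) * I) := by
          gcongr
          · norm_num
          · exact hb4.trans ha1
        _ = _ := by ring
    have t5 : 0 ≤ b ^ 2 / 2 * w' y ^ 2 := by positivity
    have t6 : 0 ≤ b ^ 6 / 6 * (w y ^ 2 * w y ^ 4) := by positivity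
    have u1 := abs_le.1 t1
    have u3 := abs_le.1 t3
    have t7 : 0 ≤ b ^ 2 * M ^ 6 * E + b ^ 2 * (a * M ^ 6) * I := by positivity
    rw [e, abs_le]
    constructor <;> linarith
  · have h : b ^ 2 * (a * ((K * M) ^ 2 + M ^ 6)) * (2 / a) = 2 * ((K * M) ^ 2 + M ^ 6) * b ^ 2 := by
      field_simp
    rw [h]
    exact le_of_eq (by ring)

/-- mass and energy of the modified profiles `Q_b`. -/
theorem Qb_mass_and_energy (P χ : ℝ → ℝ) (hP : IsProfileP P) (hχ : IsCutoff χ) :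
    ∃ C b₀ : ℝ, 0 < C ∧ 0 < b₀ ∧
      ∀ b : ℝ, 0 < |b| → |b| < b₀ →
        |(∫ y : ℝ, (Qb P χ b y) ^ 2) - (∫ y : ℝ, (Q y) ^ 2)
            - 2 * b * ∫ y : ℝ, P y * Q y| ≤ C * |b| ^ ((5 : ℝ) / 4) ∧
        |Energy (Qb P χ b) + b * ∫ y : ℝ, P y * Q y| ≤ C * b ^ 2 := by
  obtain ⟨C₁, hC₁, hmass⟩ := mass_expansion hP hχ
  obtain ⟨C₂, hC₂, henergy⟩ := energy_expansion hP hχ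
  refine ⟨C₁ + C₂ + 1, 1, by positivity, one_pos, fun b hb0 hb1 => ?_⟩
  set a := |b| ^ ((3 : ℝ) / 4) with ha
  have ha0 : 0 < a := Real.rpow_pos_of_pos hb0 _
  have ha1 : a ≤ 1 := Real.rpow_le_one hb0.le hb1.le (by norm_num)
  have hab : a ^ 2 ≤ |b| := by
    calc a ^ 2 = |b| ^ ((3 : ℝ) / 2) := by
          rw [ha, ← Real.rpow_natCast, ← Real.rpow_mul hb0.le]; norm_num
      _ ≤ |b| ^ (1 : ℝ) := Real.rpow_le_rpow_of_exponent_ge hb0 hb1.le (by norm_num)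
      _ = |b| := Real.rpow_one _
  have hbpow : b ^ 2 = |b| ^ (2 : ℝ) := by rw [Real.rpow_two, sq_abs]
  have hba : b ^ 2 ≤ a := by
    rw [hbpow]
    exact Real.rpow_le_rpow_of_exponent_ge hb0 hb1.le (by norm_num)
  have hdiv : b ^ 2 / a = |b| ^ ((5 : ℝ) / 4) := by
    rw [hbpow, ha, ← Real.rpow_sub hb0]; norm_num
  have h1 := hmass a b ha0 ha1 hab
  have h2 := henergy a b ha0 ha1 hb1.le hab hba
  rw [hdiv] at h1
  have hpos : 0 ≤ |b| ^ ((5 : ℝ) / 4) := by positivity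
  refine ⟨h1.trans ?_, h2.trans ?_⟩ <;> gcongr <;> linarith
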